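/- Let S be a board. Let V be the number of vertices of S, E the number of edges of S, and F the number of cells of S. Then V − E + F = 1. -/

import Mathlib

open scoped Matrix

/-- A cell of the integer grid, representing the closed unit square
`[p₁, p₁+1] × [p₂, p₂+1] ⊆ ℝ²`. -/
abbrev Cell : Type := ℤ × ℤ

/-- The closed unit square in `ℝ²` corresponding to a cell. -/
def unitSquare (p : Cell) : Set (ℝ × ℝ) :=
  (Set.Icc (p.1 : ℝ) ((p.1 : ℝ) + 1)) ×ˢ (Set.Icc (p.2 : ℝ) ((p.2 : ℝ) + 1))

/-- The region of the plane covered by a finite set of cells. -/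
def Region (S : Finset Cell) : Set (ℝ × ℝ) := ⋃ p ∈ S, unitSquare p

/-- A board: a finite nonempty set of cells whose region is homeomorphic to the
closed unit disk in `ℝ²`. -/
def IsBoard (S : Finset Cell) : Prop :=
  S.Nonempty ∧
    Nonempty ((Region S) ≃ₜ (Metric.closedBall (0 : EuclideanSpace ℝ (Fin 2)) 1))

/-- A cell is black if the sum of its coordinates is even. -/
def IsBlackCell (p : Cell) : Prop := Even (p.1 + p.2)

instance (p : Cell) : Decidable (IsBlackCell p) := by
  unfold IsBlackCell; infer_instance

/-- The black cells of `S`. -/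
def blackCells (S : Finset Cell) : Finset Cell := S.filter IsBlackCell

/-- The white cells of `S`. -/
def whiteCells (S : Finset Cell) : Finset Cell := S.filter fun p => ¬ IsBlackCell p

/-- Two cells are adjacent when they share an edge. -/
def Adjacent (p q : Cell) : Prop :=
  p - q = (1, 0) ∨ p - q = (-1, 0) ∨ p - q = (0, 1) ∨ p - q = (0, -1)

instance (p q : Cell) : Decidable (Adjacent p q) := by
  unfold Adjacent; infer_instance

/-- The black-to-white adjacency matrix of a set of cells, with respect to
labelings `β` of the black cells and `ω` of the white cells. -/
def btwMatrix {S : Finset Cell} {b w : ℕ}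
    (β : Fin b ≃ blackCells S) (ω : Fin w ≃ whiteCells S) :
    Matrix (Fin b) (Fin w) ℤ :=
  fun i j => if Adjacent (β i : Cell) (ω j : Cell) then 1 else 0

/-- The four vertices of a cell. -/
def cellVerts (p : Cell) : Finset Cell := {p, p + (1, 0), p + (0, 1), p + (1, 1)}

/-- `v` is a vertex of `S` if it is a vertex of some cell of `S`. -/
def IsVertex (S : Finset Cell) (v : Cell) : Prop := ∃ p ∈ S, v ∈ cellVerts p

/-- The cells of `S` incident to the vertex `v`. -/
def incidentCells (S : Finset Cell) (v : Cell) : Finset Cell :=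
  S.filter fun p => v ∈ cellVerts p

/-- The point of `ℝ²` corresponding to a grid point. -/
def toR (v : Cell) : ℝ × ℝ := ((v.1 : ℝ), (v.2 : ℝ))

/-- A boundary vertex of `S`: a vertex lying in the topological frontier of the
region of `S`. -/
def IsBoundaryVertex (S : Finset Cell) (v : Cell) : Prop :=
  IsVertex S v ∧ toR v ∈ frontier (Region S)

/-- An interior vertex of `S`: a vertex not lying in the frontier of the region
of `S`. -/
def IsInteriorVertex (S : Finset Cell) (v : Cell) : Prop :=
  IsVertex S v ∧ toR v ∉ frontier (Region S)

/-- A corner of `S`: a vertex incident to exactly one cell of `S`. -/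
def IsBoardCorner (S : Finset Cell) (v : Cell) : Prop := (incidentCells S v).card = 1

/-- `a` and `b` are opposite vertices of the cell `q`. -/
def OppositeVerts (q a b : Cell) : Prop :=
  ({a, b} : Finset Cell) = {q, q + (1, 1)} ∨
    ({a, b} : Finset Cell) = {q + (1, 0), q + (0, 1)}

/-- A pre-diagonal of `S` of length `k`: vertices `v 0, …, v k` and cells
`s 0, …, s (k-1)` as in the definition of a diagonal.  (The values of `v` at
indices `> k` and of `s` at indices `≥ k` are irrelevant.) -/
def IsPreDiagonal (S : Finset Cell) (k : ℕ) (v : ℕ → Cell) (s : ℕ → Cell) : Prop :=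
  1 ≤ k ∧
  IsBoardCorner S (v 0) ∧
  (∀ i, 0 < i → i < k → IsInteriorVertex S (v i)) ∧
  (∀ i, i < k → s i ∈ S) ∧
  (∀ i, i < k → OppositeVerts (s i) (v i) (v (i + 1))) ∧
  (∀ i, i + 1 < k → (cellVerts (s i) ∩ cellVerts (s (i + 1))).card = 1) ∧
  (∀ i j, i ≤ k → j ≤ k → i ≠ j → v i ≠ v j) ∧
  (∀ i j, i < k → j < k → i ≠ j → s i ≠ s j)

/-- The pre-diagonal `(k', v', s')` extends the pre-diagonal `(k, v, s)`. -/
def PreDiagExtends (k' : ℕ) (v' s' : ℕ → Cell) (k : ℕ) (v s : ℕ → Cell) : Prop :=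
  k ≤ k' ∧ (∀ i ≤ k, v' i = v i) ∧ (∀ i < k, s' i = s i)

/-- A diagonal: a pre-diagonal that is maximal under extension. -/
def IsDiagonal (S : Finset Cell) (k : ℕ) (v s : ℕ → Cell) : Prop :=
  IsPreDiagonal S k v s ∧
    ∀ k' v' s', IsPreDiagonal S k' v' s' → PreDiagExtends k' v' s' k v s → k' = k

/-- A good diagonal: at least one of the two unit edges of the last cell
`s (k-1)` containing the final vertex `v k` is contained in the frontier of the
region of `S`. -/
def IsGoodDiagonal (S : Finset Cell) (k : ℕ) (v s : ℕ → Cell) : Prop :=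
  IsDiagonal S k v s ∧
    ∃ a ∈ cellVerts (s (k - 1)),
      (a - v k = (1, 0) ∨ a - v k = (0, 1) ∨ a - v k = (-1, 0) ∨ a - v k = (0, -1)) ∧
      segment ℝ (toR (v k)) (toR a) ⊆ frontier (Region S)

/-- The four edges of a cell, as unordered pairs of its vertices. -/
def cellEdges (p : Cell) : Set (Sym2 Cell) :=
  {s(p, p + (1, 0)), s(p, p + (0, 1)),
    s(p + (1, 0), p + (1, 1)), s(p + (0, 1), p + (1, 1))}

/-- Every circle-valued map on a contractible space lifts to the reals. -/
lemma exists_real_lift {X : Type*} [TopologicalSpace X] [ContractibleSpace X]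
    (g : C(X, AddCircle (1 : ℝ))) :
    ∃ G : C(X, ℝ), ∀ x, ((G x : ℝ) : AddCircle (1 : ℝ)) = g x := by
  obtain ⟨y, ⟨H⟩⟩ := id_nullhomotopic X
  obtain ⟨e, he⟩ := QuotientAddGroup.mk_surjective (g y)
  have cov := AddCircle.isCoveringMap_coe (𝕜 := ℝ) (1 : ℝ)
  let K : C(unitInterval × X, AddCircle (1 : ℝ)) := g.comp H.symm.toContinuousMap
  have h0 : ∀ a, K (0, a) = ((ContinuousMap.const X e a : ℝ) : AddCircle (1 : ℝ)) := by
    intro a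
    have : H.symm (0, a) = y := by simp
    change g (H.symm (0, a)) = _
    rw [this]; exact he.symm
  refine ⟨(cov.liftHomotopy K (ContinuousMap.const X e) h0).comp
    ⟨fun x => ((1 : unitInterval), x), by fun_prop⟩, fun x => ?_⟩
  have h1 := congr_fun (cov.liftHomotopy_lifts K (ContinuousMap.const X e) h0) (1, x)
  have h2 : K (1, x) = g x := by
    change g (H.symm (1, x)) = _
    simp
  rw [← h2]; exact h1

lemma board_contractible {S : Finset Cell} (hS : IsBoard S) : ContractibleSpace (Region S) := by
  obtain ⟨-, ⟨e⟩⟩ := hS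
  have : ContractibleSpace (Metric.closedBall (0 : EuclideanSpace ℝ (Fin 2)) 1) :=
    (convex_closedBall _ _).contractibleSpace ⟨0, by simp⟩
  exact e.contractibleSpace

lemma isClosed_unitSquare (p : Cell) : IsClosed (unitSquare p) :=
  isClosed_Icc.prod isClosed_Icc

lemma isPreconnected_unitSquare (p : Cell) : IsPreconnected (unitSquare p) :=
  isPreconnected_Icc.prod isPreconnected_Icc

lemma Region_eq (S : Finset Cell) : Region S = ⋃ p : S, unitSquare p.1 := by
  unfold Region; rw [Set.iUnion_subtype]

lemma unitSquare_subset {S : Finset Cell} {p : Cell} (hp : p ∈ S) : unitSquare p ⊆ Region S :=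
  Set.subset_biUnion_of_mem (u := fun p => unitSquare p) hp

/-- Bilinear local potential of a pair of edge functions on the square of a cell. -/
noncomputable def localPot (fh fv : Cell → ℤ) (p : Cell) (x : ℝ × ℝ) : ℝ :=
  (x.1 - p.1) * fh p + (x.2 - p.2) * fv p
    + (x.1 - p.1) * (x.2 - p.2) * (fv (p + (1, 0)) - fv p)

lemma localPot_compat {S : Finset Cell} {fh fv : Cell → ℤ}
    (hc : ∀ p ∈ S, fh p + fv (p + (1, 0)) = fv p + fh (p + (0, 1)))
    {p q : Cell} (hp : p ∈ S) (hq : q ∈ S) {x : ℝ × ℝ}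
    (hxp : x ∈ unitSquare p) (hxq : x ∈ unitSquare q) :
    ∃ n : ℤ, localPot fh fv p x - localPot fh fv q x = n := by
  obtain ⟨p1, p2⟩ := p
  obtain ⟨q1, q2⟩ := q
  obtain ⟨x, y⟩ := x
  simp only [unitSquare, Set.mem_prod, Set.mem_Icc] at hxp hxq
  obtain ⟨⟨a1, a2⟩, a3, a4⟩ := hxp
  obtain ⟨⟨b1, b2⟩, b3, b4⟩ := hxq
  have c1 : p1 ≤ q1 + 1 := by exact_mod_cast a1.trans b2
  have c2 : q1 ≤ p1 + 1 := by exact_mod_cast b1.trans a2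
  have c3 : p2 ≤ q2 + 1 := by exact_mod_cast a3.trans b4
  have c4 : q2 ≤ p2 + 1 := by exact_mod_cast b3.trans a4
  have hx : q1 ≠ p1 → ∃ m : ℤ, x = m := by
    intro h
    rcases lt_or_gt_of_ne h with h | h
    · have : p1 = q1 + 1 := by omega
      subst this
      push_cast at *
      exact ⟨q1 + 1, by push_cast; linarith⟩
    · have : q1 = p1 + 1 := by omega
      subst this
      push_cast at *
      exact ⟨p1 + 1, by push_cast; linarith⟩
  have hy : q2 ≠ p2 → ∃ m : ℤ, y = m := by
    intro h
    rcases lt_or_gt_of_ne h with h | h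
    · have : p2 = q2 + 1 := by omega
      subst this
      push_cast at *
      exact ⟨q2 + 1, by push_cast; linarith⟩
    · have : q2 = p2 + 1 := by omega
      subst this
      push_cast at *
      exact ⟨p2 + 1, by push_cast; linarith⟩
  have hcp := hc _ hp
  have hcq := hc _ hq
  simp only [Prod.mk_add_mk, add_zero] at hcp hcq
  have hcp' : (fh (p1, p2) : ℝ) + fv (p1 + 1, p2) = fv (p1, p2) + fh (p1, p2 + 1) := by
    exact_mod_cast hcp
  have hcq' : (fh (q1, q2) : ℝ) + fv (q1 + 1, q2) = fv (q1, q2) + fh (q1, q2 + 1) := by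
    exact_mod_cast hcq
  simp only [localPot, Prod.mk_add_mk, add_zero]
  by_cases h1 : q1 = p1
  · subst h1
    by_cases h2 : q2 = p2
    · subst h2; exact ⟨0, by simp⟩
    · rcases lt_or_gt_of_ne h2 with h | h
      · have : p2 = q2 + 1 := by omega
        subst this
        push_cast at *
        have hy' : y = q2 + 1 := by linarith
        subst hy'
        refine ⟨-fv (q1, q2), ?_⟩
        push_cast
        linear_combination (x - q1) * (-hcq')
      · have : q2 = p2 + 1 := by omega
        subst this
        push_cast at *
        have hy' : y = p2 + 1 := by linarith
        subst hy'
        refine ⟨fv (q1, p2), ?_⟩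
        push_cast
        linear_combination (x - q1) * hcp'
  · by_cases h2 : q2 = p2
    · subst h2
      rcases lt_or_gt_of_ne h1 with h | h
      · have : p1 = q1 + 1 := by omega
        subst this
        push_cast at *
        have hy' : x = q1 + 1 := by linarith
        subst hy'
        refine ⟨-fh (q1, q2), ?_⟩
        push_cast
        ring
      · have : q1 = p1 + 1 := by omega
        subst this
        push_cast at *
        have hy' : x = p1 + 1 := by linarith
        subst hy'
        refine ⟨fh (p1, q2), ?_⟩
        push_cast
        ring
    · obtain ⟨m, rfl⟩ := hx h1
      obtain ⟨k, rfl⟩ := hy h2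
      refine ⟨(m - p1) * fh (p1, p2) + (k - p2) * fv (p1, p2)
        + (m - p1) * (k - p2) * (fv (p1 + 1, p2) - fv (p1, p2))
        - ((m - q1) * fh (q1, q2) + (k - q2) * fv (q1, q2)
        + (m - q1) * (k - q2) * (fv (q1 + 1, q2) - fv (q1, q2))), ?_⟩
      push_cast
      ring

lemma addCircle_coe_eq {a b : ℝ} :
    (a : AddCircle (1 : ℝ)) = b ↔ ∃ n : ℤ, a - b = n := by
  rw [← sub_eq_zero, ← AddCircle.coe_sub, AddCircle.coe_eq_zero_iff]
  simp [eq_comm]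

lemma exists_global {S : Finset Cell} (hS : IsBoard S) {fh fv : Cell → ℤ}
    (hc : ∀ p ∈ S, fh p + fv (p + (1, 0)) = fv p + fh (p + (0, 1))) :
    ∃ G : ℝ × ℝ → ℝ, ContinuousOn G (Region S) ∧ ∀ p ∈ S, ∀ x ∈ unitSquare p,
      ∃ n : ℤ, G x - localPot fh fv p x = n := by
  classical
  have := board_contractible hS
  have hmem : ∀ x ∈ Region S, ∃ p ∈ S, x ∈ unitSquare p := by
    intro x hx; simpa [Region] using hx
  let g : ℝ × ℝ → AddCircle (1 : ℝ) := fun x =>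
    if h : x ∈ Region S then (localPot fh fv (hmem x h).choose x : ℝ) else 0
  have hg : ∀ p ∈ S, ∀ x ∈ unitSquare p, g x = (localPot fh fv p x : ℝ) := by
    intro p hp x hx
    have hxR := unitSquare_subset hp hx
    simp only [g, dif_pos hxR]
    have hs := (hmem x hxR).choose_spec
    exact addCircle_coe_eq.2 (localPot_compat hc hs.1 hp hs.2 hx)
  have hgc : ContinuousOn g (Region S) := by
    rw [Region_eq]
    refine (locallyFinite_of_finite _).continuousOn_iUnion (fun p => isClosed_unitSquare _) ?_
    intro p
    refine ContinuousOn.congr (f := fun x => ((localPot fh fv p x : ℝ) : AddCircle (1 : ℝ))) ?_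
      (hg p p.2)
    refine Continuous.continuousOn ?_
    refine (AddCircle.continuous_mk' (1 : ℝ)).comp ?_
    unfold localPot
    fun_prop
  obtain ⟨G, hG⟩ := exists_real_lift ⟨(Region S).domRestrict g, hgc.domRestrict⟩
  refine ⟨fun x => if h : x ∈ Region S then G ⟨x, h⟩ else 0, ?_, ?_⟩
  · rw [continuousOn_iff_continuous_domRestrict]
    convert G.continuous using 1
    ext ⟨x, hx⟩
    simp [hx]
  · intro p hp x hx
    have hxR := unitSquare_subset hp hx
    simp only [dif_pos hxR]
    apply addCircle_coe_eq.1
    rw [hG, ← hg p hp x hx]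
    rfl

/-- Vanishing of the first (cubical) cohomology of a board. -/
lemma exists_potential {S : Finset Cell} (hS : IsBoard S) {fh fv : Cell → ℤ}
    (hc : ∀ p ∈ S, fh p + fv (p + (1, 0)) = fv p + fh (p + (0, 1))) :
    ∃ φ : Cell → ℤ, ∀ p ∈ S, φ (p + (1, 0)) - φ p = fh p ∧ φ (p + (0, 1)) - φ p = fv p ∧
      φ (p + (1, 1)) - φ (p + (0, 1)) = fh (p + (0, 1)) ∧
      φ (p + (1, 1)) - φ (p + (1, 0)) = fv (p + (1, 0)) := by
  obtain ⟨G, hGc, hG⟩ := exists_global hS hc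
  refine ⟨fun v => round (G (toR v)), fun p hp => ?_⟩
  have hconst : ∀ x ∈ unitSquare p, ∀ y ∈ unitSquare p,
      G x - localPot fh fv p x = G y - localPot fh fv p y := by
    intro x hx y hy
    have : DiscreteTopology (Set.range ((↑) : ℤ → ℝ)) :=
      Int.isClosedEmbedding_coe_real.isEmbedding.toHomeomorph.symm.isEmbedding.discreteTopology
    refine (isPreconnected_unitSquare p).constant_of_mapsTo (T := Set.range ((↑) : ℤ → ℝ))
      (f := fun x => G x - localPot fh fv p x) ⟨this⟩ ?_ ?_ hx hy
    · refine (hGc.mono (unitSquare_subset hp)).sub (Continuous.continuousOn ?_)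
      unfold localPot
      fun_prop
    · intro z hz
      obtain ⟨n, hn⟩ := hG p hp z hz
      exact ⟨n, hn.symm⟩
  have m0 : toR p ∈ unitSquare p := by simp [toR, unitSquare]
  have m1 : toR (p + (1, 0)) ∈ unitSquare p := by simp [toR, unitSquare]
  have m2 : toR (p + (0, 1)) ∈ unitSquare p := by simp [toR, unitSquare]
  have m3 : toR (p + (1, 1)) ∈ unitSquare p := by simp [toR, unitSquare]
  obtain ⟨n, hn⟩ := hG p hp _ m0
  have e0 : G (toR p) = (n : ℤ) := by
    rw [← hn]; simp [toR, localPot]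
  have e1 : G (toR (p + (1, 0))) = ((n + fh p : ℤ) : ℝ) := by
    have := hconst _ m1 _ m0
    rw [hn] at this
    simp [toR, localPot] at this ⊢
    linarith
  have e2 : G (toR (p + (0, 1))) = ((n + fv p : ℤ) : ℝ) := by
    have := hconst _ m2 _ m0
    rw [hn] at this
    simp [toR, localPot] at this ⊢
    linarith
  have e3 : G (toR (p + (1, 1))) = ((n + fh p + fv (p + (1, 0)) : ℤ) : ℝ) := by
    have := hconst _ m3 _ m0
    rw [hn] at this
    simp [toR, localPot] at this ⊢
    linarith
  have := hc p hp
  simp only [e0, e1, e2, e3, round_intCast]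
  omega

/-- Connectedness: a function constant along edges is constant. -/
lemma const_of_edges {S : Finset Cell} (hS : IsBoard S) {φ : Cell → ℤ}
    (h : ∀ p ∈ S, φ (p + (1, 0)) = φ p ∧ φ (p + (0, 1)) = φ p ∧ φ (p + (1, 1)) = φ p) :
    ∀ p ∈ S, ∀ q ∈ S, φ p = φ q := by
  have := board_contractible hS
  have hpre : IsPreconnected (Region S) := isPreconnected_iff_preconnectedSpace.2 inferInstance
  let g : ℝ × ℝ → ℤ := fun x => φ (⌊x.1⌋, ⌊x.2⌋)
  have hfl : ∀ (a : ℤ) (t : ℝ), t ∈ Set.Icc (a : ℝ) (a + 1) → ⌊t⌋ = a ∨ ⌊t⌋ = a + 1 := by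
    intro a t ht
    rcases eq_or_lt_of_le ht.2 with h | h
    · right; rw [h]; simp
    · left; exact Int.floor_eq_iff.2 ⟨ht.1, h⟩
  have hg : ∀ p ∈ S, ∀ x ∈ unitSquare p, g x = φ p := by
    intro p hp x hx
    obtain ⟨h1, h2, h3⟩ := h p hp
    obtain ⟨p1, p2⟩ := p
    simp only [Prod.mk_add_mk, add_zero] at h1 h2 h3
    rcases hfl _ _ hx.1 with e | e <;> rcases hfl _ _ hx.2 with e' | e' <;> simp [g, e, e', *]
  have hgc : ContinuousOn g (Region S) := by
    rw [Region_eq]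
    refine (locallyFinite_of_finite _).continuousOn_iUnion (fun p => isClosed_unitSquare _) ?_
    intro p
    exact (continuousOn_const (c := φ p)).congr (hg p p.2)
  intro p hp q hq
  have mp : toR p ∈ unitSquare p := by simp [toR, unitSquare]
  have mq : toR q ∈ unitSquare q := by simp [toR, unitSquare]
  rw [← hg p hp _ mp, ← hg q hq _ mq]
  exact hpre.constant hgc (unitSquare_subset hp mp) (unitSquare_subset hq mq)

/-- Vertices, horizontal edges (by left endpoint), vertical edges (by lower endpoint). -/
def vertSet (S : Finset Cell) : Finset Cell := S.biUnion cellVerts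

def horSet (S : Finset Cell) : Finset Cell := S ∪ S.image (· + (0, 1))

def verSet (S : Finset Cell) : Finset Cell := S ∪ S.image (· + (1, 0))

lemma card_edges (S : Finset Cell) :
    {e : Sym2 Cell | ∃ p ∈ S, e ∈ cellEdges p}.ncard = (horSet S).card + (verSet S).card := by
  classical
  have hset : {e : Sym2 Cell | ∃ p ∈ S, e ∈ cellEdges p} =
      (((horSet S).image (fun v => s(v, v + (1, 0))) ∪
        (verSet S).image (fun v => s(v, v + (0, 1))) : Finset (Sym2 Cell)) : Set (Sym2 Cell)) := by
    ext e
    simp only [Set.mem_ofPred_eq, cellEdges, Set.mem_insert_iff, Set.mem_singleton_iff,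
      Finset.coe_union, Finset.coe_image, Set.mem_union, Set.mem_image, horSet, verSet,
      Finset.mem_coe]
    have r1 : ∀ p : Cell, p + (0, 1) + (1, 0) = p + (1, 1) := by intro p; ext <;> simp
    have r2 : ∀ p : Cell, p + (1, 0) + (0, 1) = p + (1, 1) := by intro p; ext <;> simp
    constructor
    · rintro ⟨p, hp, rfl | rfl | rfl | rfl⟩
      · exact Or.inl ⟨p, Or.inl hp, rfl⟩
      · exact Or.inr ⟨p, Or.inl hp, rfl⟩
      · exact Or.inr ⟨p + (1, 0), Or.inr ⟨p, hp, rfl⟩, by rw [r2]⟩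
      · exact Or.inl ⟨p + (0, 1), Or.inr ⟨p, hp, rfl⟩, by rw [r1]⟩
    · rintro (⟨v, hv | ⟨p, hp, rfl⟩, rfl⟩ | ⟨v, hv | ⟨p, hp, rfl⟩, rfl⟩)
      · exact ⟨v, hv, by simp⟩
      · exact ⟨p, hp, by rw [r1]; simp⟩
      · exact ⟨v, hv, by simp⟩
      · exact ⟨p, hp, by rw [r2]; simp⟩
  rw [hset, Set.ncard_coe_finset, Finset.card_union_of_disjoint, Finset.card_image_of_injective,
    Finset.card_image_of_injective]
  · rintro ⟨a, b⟩ ⟨c, d⟩ h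
    simp only [Sym2.eq_iff, Prod.mk_add_mk, Prod.mk.injEq] at h ⊢
    omega
  · rintro ⟨a, b⟩ ⟨c, d⟩ h
    simp only [Sym2.eq_iff, Prod.mk_add_mk, Prod.mk.injEq] at h ⊢
    omega
  · rw [Finset.disjoint_left]
    rintro e h1 h2
    obtain ⟨⟨a, b⟩, -, rfl⟩ := Finset.mem_image.1 h1
    obtain ⟨⟨c, d⟩, -, h⟩ := Finset.mem_image.1 h2
    simp only [Sym2.eq_iff, Prod.mk_add_mk, Prod.mk.injEq] at h
    omega

/-- Extension by zero of a function on a finset of grid points. -/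
def extZ (T : Finset Cell) : (T → ℤ) →ₗ[ℤ] (Cell → ℤ) where
  toFun f v := if h : v ∈ T then f ⟨v, h⟩ else 0
  map_add' f g := by ext v; by_cases h : v ∈ T <;> simp [h]
  map_smul' c f := by ext v; by_cases h : v ∈ T <;> simp [h]

lemma extZ_apply {T : Finset Cell} (f : T → ℤ) (v : T) : extZ T f v = f v := by
  simp [extZ]

lemma extZ_restrict {T : Finset Cell} (φ : Cell → ℤ) {v : Cell} (h : v ∈ T) :
    extZ T (fun v => φ v) v = φ v := by
  simp [extZ, h]

def dZero (S : Finset Cell) :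
    (vertSet S → ℤ) →ₗ[ℤ] (horSet S → ℤ) × (verSet S → ℤ) where
  toFun f := (fun e => extZ _ f ((e : Cell) + (1, 0)) - extZ _ f e,
    fun e => extZ _ f ((e : Cell) + (0, 1)) - extZ _ f e)
  map_add' f g := by ext e <;> simp <;> ring
  map_smul' c f := by
    ext e <;> simp only [map_smul, Pi.smul_apply, smul_eq_mul, Prod.smul_mk, RingHom.id_apply] <;>
      ring

def dOne (S : Finset Cell) :
    (horSet S → ℤ) × (verSet S → ℤ) →ₗ[ℤ] (S → ℤ) where
  toFun f := fun p => extZ _ f.1 p + extZ _ f.2 ((p : Cell) + (1, 0)) - extZ _ f.2 p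
    - extZ _ f.1 ((p : Cell) + (0, 1))
  map_add' f g := by ext e; simp; ring
  map_smul' c f := by
    ext e
    simp only [map_smul, Pi.smul_apply, smul_eq_mul, Prod.smul_fst, Prod.smul_snd,
      RingHom.id_apply]
    ring

section
variable {S : Finset Cell} {p : Cell}

lemma vert0 (hp : p ∈ S) : p ∈ vertSet S :=
  Finset.mem_biUnion.2 ⟨p, hp, by simp [cellVerts]⟩
lemma vert1 (hp : p ∈ S) : p + (1, 0) ∈ vertSet S :=
  Finset.mem_biUnion.2 ⟨p, hp, by simp [cellVerts]⟩
lemma vert2 (hp : p ∈ S) : p + (0, 1) ∈ vertSet S :=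
  Finset.mem_biUnion.2 ⟨p, hp, by simp [cellVerts]⟩
lemma vert3 (hp : p ∈ S) : p + (1, 1) ∈ vertSet S :=
  Finset.mem_biUnion.2 ⟨p, hp, by simp [cellVerts]⟩
lemma hor0 (hp : p ∈ S) : p ∈ horSet S := Finset.mem_union_left _ hp
lemma hor1 (hp : p ∈ S) : p + (0, 1) ∈ horSet S :=
  Finset.mem_union_right _ (Finset.mem_image_of_mem _ hp)
lemma ver0 (hp : p ∈ S) : p ∈ verSet S := Finset.mem_union_left _ hp
lemma ver1 (hp : p ∈ S) : p + (1, 0) ∈ verSet S :=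
  Finset.mem_union_right _ (Finset.mem_image_of_mem _ hp)
end

lemma add_hv (p : Cell) : p + (0, 1) + (1, 0) = p + (1, 1) := by ext <;> simp

lemma add_vh (p : Cell) : p + (1, 0) + (0, 1) = p + (1, 1) := by ext <;> simp

/-- Value of `dZero` in terms of any function on the plane. -/
lemma dZero_eq_iff (S : Finset Cell) (f : vertSet S → ℤ) (w : (horSet S → ℤ) × (verSet S → ℤ)) :
    dZero S f = w ↔ ∀ p ∈ S,
      extZ _ f (p + (1, 0)) - extZ _ f p = extZ _ w.1 p ∧
      extZ _ f (p + (0, 1)) - extZ _ f p = extZ _ w.2 p ∧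
      extZ _ f (p + (1, 1)) - extZ _ f (p + (0, 1)) = extZ _ w.1 (p + (0, 1)) ∧
      extZ _ f (p + (1, 1)) - extZ _ f (p + (1, 0)) = extZ _ w.2 (p + (1, 0)) := by
  constructor
  · rintro rfl p hp
    refine ⟨?_, ?_, ?_, ?_⟩
    · exact (extZ_apply (dZero S f).1 ⟨p, hor0 hp⟩).symm
    · exact (extZ_apply (dZero S f).2 ⟨p, ver0 hp⟩).symm
    · rw [← add_hv]; exact (extZ_apply (dZero S f).1 ⟨_, hor1 hp⟩).symm
    · rw [← add_vh]; exact (extZ_apply (dZero S f).2 ⟨_, ver1 hp⟩).symm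
  · intro h
    apply Prod.ext
    · funext ⟨e, he⟩
      rw [← extZ_apply w.1]
      change extZ _ f (e + (1, 0)) - extZ _ f e = _
      rcases Finset.mem_union.1 he with he' | he'
      · exact (h e he').1
      · obtain ⟨p, hp, rfl⟩ := Finset.mem_image.1 he'
        simp only [add_hv]
        exact (h p hp).2.2.1
    · funext ⟨e, he⟩
      rw [← extZ_apply w.2]
      change extZ _ f (e + (0, 1)) - extZ _ f e = _
      rcases Finset.mem_union.1 he with he' | he'
      · exact (h e he').2.1
      · obtain ⟨p, hp, rfl⟩ := Finset.mem_image.1 he'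
        simp only [add_vh]
        exact (h p hp).2.2.2

lemma range_dZero {S : Finset Cell} (hS : IsBoard S) :
    LinearMap.range (dZero S) = LinearMap.ker (dOne S) := by
  ext w
  rw [LinearMap.mem_range, LinearMap.mem_ker]
  constructor
  · rintro ⟨f, hf⟩
    rw [dZero_eq_iff] at hf
    funext ⟨p, hp⟩
    obtain ⟨h1, h2, h3, h4⟩ := hf p hp
    change extZ _ w.1 p + extZ _ w.2 (p + (1, 0)) - extZ _ w.2 p - extZ _ w.1 (p + (0, 1)) = 0
    linarith
  · intro h
    obtain ⟨φ, hφ⟩ := exists_potential hS (fh := extZ _ w.1) (fv := extZ _ w.2) (by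
      intro p hp
      have : extZ _ w.1 p + extZ _ w.2 (p + (1, 0)) - extZ _ w.2 p - extZ _ w.1 (p + (0, 1)) = 0 :=
        congr_fun h ⟨p, hp⟩
      linarith)
    refine ⟨fun v => φ v, (dZero_eq_iff _ _ _).2 fun p hp => ?_⟩
    rw [extZ_restrict φ (vert0 hp), extZ_restrict φ (vert1 hp), extZ_restrict φ (vert2 hp),
      extZ_restrict φ (vert3 hp)]
    exact hφ p hp

lemma range_dOne (S : Finset Cell) : LinearMap.range (dOne S) = ⊤ := by
  rw [LinearMap.range_eq_top]
  intro g
  let F : Cell → ℤ := fun v => ∑ q ∈ S with q.1 = v.1 ∧ q.2 < v.2, extZ S g q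
  refine ⟨(fun e => - F e, 0), ?_⟩
  funext ⟨p, hp⟩
  change extZ _ (fun e : horSet S => - F e) p + extZ _ (0 : verSet S → ℤ) (p + (1, 0))
    - extZ _ (0 : verSet S → ℤ) p - extZ _ (fun e : horSet S => - F e) (p + (0, 1)) = _
  rw [extZ_restrict (fun e => - F e) (hor0 hp), extZ_restrict (fun e => - F e) (hor1 hp),
    map_zero, ← extZ_apply g]
  have : (S.filter fun q => q.1 = (p + (0, 1)).1 ∧ q.2 < (p + (0, 1)).2) =
      insert p (S.filter fun q => q.1 = p.1 ∧ q.2 < p.2) := by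
    ext ⟨a, b⟩
    obtain ⟨c, d⟩ := p
    simp only [Finset.mem_filter, Finset.mem_insert, Prod.mk_add_mk, Prod.mk.injEq]
    constructor
    · rintro ⟨h, h1, h2⟩
      by_cases hbd : b = d
      · left; omega
      · right; exact ⟨h, by omega, by omega⟩
    · rintro (⟨rfl, rfl⟩ | ⟨h, h1, h2⟩)
      · exact ⟨hp, by omega, by omega⟩
      · exact ⟨h, by omega, by omega⟩
  have hF : F (p + (0, 1)) = extZ S g p + F p := by
    simp only [F]
    rw [this, Finset.sum_insert (by simp)]
  rw [hF]
  simp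

lemma finrank_ker_dZero {S : Finset Cell} (hS : IsBoard S) :
    Module.finrank ℤ (LinearMap.ker (dZero S)) = 1 := by
  obtain ⟨p0, hp0⟩ := hS.1
  let one : LinearMap.ker (dZero S) := ⟨fun _ => 1, by
    rw [LinearMap.mem_ker, dZero_eq_iff]
    intro p hp
    have e := fun {v} (h : v ∈ vertSet S) => extZ_restrict (fun _ => (1 : ℤ)) h
    rw [e (vert0 hp), e (vert1 hp), e (vert2 hp), e (vert3 hp)]
    simp⟩
  have key : ∀ f ∈ LinearMap.ker (dZero S), ∀ v, f v = f ⟨p0, vert0 hp0⟩ := by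
    intro f hf v
    rw [LinearMap.mem_ker, dZero_eq_iff] at hf
    have h : ∀ p ∈ S, extZ _ f (p + (1, 0)) = extZ _ f p ∧ extZ _ f (p + (0, 1)) = extZ _ f p ∧
        extZ _ f (p + (1, 1)) = extZ _ f p := by
      intro p hp
      have := hf p hp
      simp only [Prod.fst_zero, Prod.snd_zero, map_zero, Pi.zero_apply] at this
      omega
    obtain ⟨v, hv⟩ := v
    rw [← extZ_apply f, ← extZ_apply f]
    obtain ⟨p, hp, hvp⟩ := Finset.mem_biUnion.1 hv
    rw [← const_of_edges hS h p hp p0 hp0]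
    simp only [cellVerts, Finset.mem_insert, Finset.mem_singleton] at hvp
    obtain ⟨h1, h2, h3⟩ := h p hp
    rcases hvp with rfl | rfl | rfl | rfl
    · rfl
    · exact h1
    · exact h2
    · exact h3
  let e : LinearMap.ker (dZero S) ≃ₗ[ℤ] ℤ :=
    { toFun := fun f => f.1 ⟨p0, vert0 hp0⟩
      map_add' := fun f g => rfl
      map_smul' := fun c f => rfl
      invFun := fun c => c • one
      left_inv := by
        intro f
        apply Subtype.ext
        funext v
        rw [key f.1 f.2 v]
        simp [one]
      right_inv := by intro c; simp [one] }
  rw [e.finrank_eq]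
  simp

lemma rank_nullity {M N : Type} [AddCommGroup M] [AddCommGroup N] [Module.Finite ℤ M]
    (f : M →ₗ[ℤ] N) :
    Module.finrank ℤ (LinearMap.range f) + Module.finrank ℤ (LinearMap.ker f)
      = Module.finrank ℤ M := by
  rw [← f.quotKerEquivRange.finrank_eq]
  exact Submodule.finrank_quotient_add_finrank _

/-- **Lemma (Euler).** For a board, `V - E + F = 1`, where `V`, `E`, `F` count
vertices, edges and cells. -/
theorem euler_formula_board
    (S : Finset Cell) (hS : IsBoard S) :
    ({v : Cell | IsVertex S v}.ncard : ℤ)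
      - {e : Sym2 Cell | ∃ p ∈ S, e ∈ cellEdges p}.ncard
      + S.card = 1 := by

  have hV : {v : Cell | IsVertex S v} = (vertSet S : Set Cell) := by
    ext v; simp [IsVertex, vertSet]
  rw [card_edges, hV, Set.ncard_coe_finset]
  have h0 := rank_nullity (dZero S)
  have h1 := rank_nullity (dOne S)
  rw [finrank_ker_dZero hS, range_dZero hS] at h0
  rw [range_dOne, finrank_top, Module.finrank_prod] at h1
  simp only [Module.finrank_fintype_fun_eq_card, Fintype.card_coe] at h0 h1
  omega
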